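/- arXiv:2505.15964 — 3 statements merged into one kernel-verified Lean document; each statement's English description precedes it below -/
import Mathlib

section
/- Let m, n ≥ 1 and let ξ ∈ ℝ^{n×m} be totally irrational. Let ‖·‖₁ be an arbitrary norm on ℝ^m and ‖·‖₂ an arbitrary norm on ℝ^n, and let (X'_i), (L'_i) be the sequences of norms of best approximation vectors and of remainders for ξ computed with respect to this pair of norms, while (X_i), (L_i) are those computed with respect to the sup norms. Then: sup_{i≥1} X_{i+1}/X_i < ∞ if and only if sup_{i≥1} X'_{i+1}/X'_i < ∞; and sup_{i≥1} L_i/L_{i+1} < ∞ if and only if sup_{i≥1} L'_i/L'_{i+1} < ∞. -/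
open Filter

/-- The sup-norm of the `i`-th integer vector `x i`, viewed in `ℝ^m`. -/
noncomputable def Xval {m : ℕ} (x : ℕ → Fin m → ℤ) (i : ℕ) : ℝ :=
  ‖(fun j => (x i j : ℝ))‖

/-- The sup-norm of the remainder `ξ 𝒙ᵢ − 𝒚ᵢ`. -/
noncomputable def Lval {m n : ℕ} (ξ : Matrix (Fin n) (Fin m) ℝ)
    (x : ℕ → Fin m → ℤ) (y : ℕ → Fin n → ℤ) (i : ℕ) : ℝ :=
  ‖(ξ.mulVec (fun j => (x i j : ℝ)) - (fun k => (y i k : ℝ)))‖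

/-- `ξ` is totally irrational: `‖ξ𝒙 − 𝒚‖ > 0` for every nonzero integer pair `(𝒙,𝒚)`. -/
def TotallyIrrational {m n : ℕ} (ξ : Matrix (Fin n) (Fin m) ℝ) : Prop :=
  ∀ (u : Fin m → ℤ) (v : Fin n → ℤ), (u, v) ≠ 0 →
    0 < ‖(ξ.mulVec (fun j => (u j : ℝ)) - (fun k => (v k : ℝ)))‖

/-- `(𝒙ᵢ, 𝒚ᵢ)_{i}` is a sequence of best approximation vectors for `ξ`
(with respect to the sup norms). -/
structure IsBestApproxSeq {m n : ℕ} (ξ : Matrix (Fin n) (Fin m) ℝ)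
    (x : ℕ → Fin m → ℤ) (y : ℕ → Fin n → ℤ) : Prop where
  nonzero : ∀ i, x i ≠ 0
  first : Xval x 0 = 1
  xStrictMono : StrictMono (Xval x)
  lStrictAnti : StrictAnti (Lval ξ x y)
  best : ∀ (i : ℕ) (u : Fin m → ℤ) (v : Fin n → ℤ), u ≠ 0 →
    ‖(fun j => (u j : ℝ))‖ < Xval x (i + 1) →
    Lval ξ x y i ≤ ‖(ξ.mulVec (fun j => (u j : ℝ)) - (fun k => (v k : ℝ)))‖

/-- Property (A): `ξ` is badly approximable. -/
def PropA {m n : ℕ} (ξ : Matrix (Fin n) (Fin m) ℝ) : Prop :=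
  ∃ c : ℝ, 0 < c ∧ ∀ (u : Fin m → ℤ) (v : Fin n → ℤ), u ≠ 0 →
    c ≤ ‖(fun j => (u j : ℝ))‖ ^ m *
        ‖(ξ.mulVec (fun j => (u j : ℝ)) - (fun k => (v k : ℝ)))‖ ^ n

/-- Property (B): the ratios `X_{i+1}/X_i` are bounded. -/
def PropB {m : ℕ} (x : ℕ → Fin m → ℤ) : Prop :=
  ∃ M : ℝ, ∀ i : ℕ, Xval x (i + 1) / Xval x i ≤ M

/-- Property (C): the ratios `L_i/L_{i+1}` are bounded. -/
def PropC {m n : ℕ} (ξ : Matrix (Fin n) (Fin m) ℝ)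
    (x : ℕ → Fin m → ℤ) (y : ℕ → Fin n → ℤ) : Prop :=
  ∃ M : ℝ, ∀ i : ℕ, Lval ξ x y i / Lval ξ x y (i + 1) ≤ M

/-- The ordinary exponent `ω(ξ) = limsup (−log Lᵢ)/(log Xᵢ)`, as a value in `[0,+∞]`. -/
noncomputable def ordExp {m n : ℕ} (ξ : Matrix (Fin n) (Fin m) ℝ)
    (x : ℕ → Fin m → ℤ) (y : ℕ → Fin n → ℤ) : EReal :=
  limsup (fun i => ((-Real.log (Lval ξ x y i) / Real.log (Xval x i) : ℝ) : EReal)) atTop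

/-- The uniform exponent `ω̂(ξ) = liminf (−log Lᵢ)/(log X_{i+1})`, as a value in `[0,+∞]`. -/
noncomputable def unifExp {m n : ℕ} (ξ : Matrix (Fin n) (Fin m) ℝ)
    (x : ℕ → Fin m → ℤ) (y : ℕ → Fin n → ℤ) : EReal :=
  liminf (fun i => ((-Real.log (Lval ξ x y i) / Real.log (Xval x (i + 1)) : ℝ) : EReal)) atTop

/-- `N` is a norm on `ℝ^k`. -/
def IsNorm {k : ℕ} (N : (Fin k → ℝ) → ℝ) : Prop :=
  (∀ v, 0 ≤ N v) ∧ (∀ v, N v = 0 ↔ v = 0) ∧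
  (∀ (c : ℝ) (v : Fin k → ℝ), N (c • v) = |c| * N v) ∧
  (∀ v w, N (v + w) ≤ N v + N w)

/-- `(𝒙ᵢ, 𝒚ᵢ)_{i}` is a sequence of best approximation vectors for `ξ` with
respect to the pair of norms `N₁` (on `ℝ^m`) and `N₂` (on `ℝ^n`). -/
structure IsBestApproxSeqWith {m n : ℕ} (ξ : Matrix (Fin n) (Fin m) ℝ)
    (N₁ : (Fin m → ℝ) → ℝ) (N₂ : (Fin n → ℝ) → ℝ)
    (x : ℕ → Fin m → ℤ) (y : ℕ → Fin n → ℤ) : Prop where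
  nonzero : ∀ i, x i ≠ 0
  xStrictMono : StrictMono (fun i => N₁ (fun j => (x i j : ℝ)))
  lStrictAnti : StrictAnti
    (fun i => N₂ (ξ.mulVec (fun j => (x i j : ℝ)) - (fun k => (y i k : ℝ))))
  best : ∀ (i : ℕ) (u : Fin m → ℤ) (v : Fin n → ℤ), u ≠ 0 →
    N₁ (fun j => (u j : ℝ)) < N₁ (fun j => (x (i + 1) j : ℝ)) →
    N₂ (ξ.mulVec (fun j => (x i j : ℝ)) - (fun k => (y i k : ℝ))) ≤
      N₂ (ξ.mulVec (fun j => (u j : ℝ)) - (fun k => (v k : ℝ)))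

/-- Any norm on `ℝ^k` is equivalent to the sup norm. -/
theorem IsNorm.exists_equiv_sup {k : ℕ} {N : (Fin k → ℝ) → ℝ} (hN : IsNorm N) :
    ∃ K : ℝ, 1 ≤ K ∧ ∀ v, N v ≤ K * ‖v‖ ∧ ‖v‖ ≤ K * N v := by
  have general : ∀ (V : Type) [NormedAddCommGroup V] [NormedSpace ℝ V]
      (e : (Fin k → ℝ) ≃ₗ[ℝ] V),
      ∃ K : ℝ, 1 ≤ K ∧ ∀ v, ‖e v‖ ≤ K * ‖v‖ ∧ ‖v‖ ≤ K * ‖e v‖ := by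
    intro V _ _ e
    have : FiniteDimensional ℝ V := LinearEquiv.finiteDimensional e
    let f : (Fin k → ℝ) ≃L[ℝ] V := e.toContinuousLinearEquiv
    let g : (Fin k → ℝ) →L[ℝ] V := f
    let h : V →L[ℝ] (Fin k → ℝ) := f.symm
    refine ⟨1 + ‖g‖ + ‖h‖, by linarith [norm_nonneg g, norm_nonneg h], fun v => ⟨?_, ?_⟩⟩
    · exact (g.le_opNorm v).trans <| mul_le_mul_of_nonneg_right
        (by linarith [norm_nonneg h]) (norm_nonneg v)
    · have hv : h (e v) = v := f.symm_apply_apply v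
      calc ‖v‖ = ‖h (e v)‖ := by rw [hv]
        _ ≤ ‖h‖ * ‖e v‖ := h.le_opNorm _
        _ ≤ _ := mul_le_mul_of_nonneg_right (by linarith [norm_nonneg g]) (norm_nonneg _)
  obtain ⟨h0, hz, hs, ha⟩ := hN
  let inst : Norm (Fin k → ℝ) := ⟨N⟩
  have core : @NormedSpace.Core ℝ (Fin k → ℝ) _ _ _ inst :=
    @NormedSpace.Core.mk ℝ (Fin k → ℝ) _ _ _ inst
      (@SeminormedSpace.Core.mk ℝ (Fin k → ℝ) _ _ inst _ h0 hs ha) (fun v => hz v)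
  let group := @NormedAddCommGroup.ofCore ℝ (Fin k → ℝ) _ _ _ inst core
  let space := @NormedSpace.ofCore ℝ (Fin k → ℝ) _ group.toSeminormedAddCommGroup _ core
  exact @general (Fin k → ℝ) group space (LinearEquiv.refl ℝ _)

theorem isNorm_sup (k : ℕ) : IsNorm (fun v : Fin k → ℝ => ‖v‖) :=
  ⟨norm_nonneg, fun _ => norm_eq_zero, norm_smul, norm_add_le⟩

theorem IsNorm.three_mul_le {k : ℕ} {N : (Fin k → ℝ) → ℝ} (hN : IsNorm N)
    {u v w : Fin k → ℝ} (h : (3 : ℝ) • w = u - v) : 3 * N w ≤ N u + N v := by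
  obtain ⟨-, -, hs, ha⟩ := hN
  have h1 := hs 3 w
  have h2 := ha u ((-1 : ℝ) • v)
  rw [hs] at h2
  rw [h] at h1
  have h3 : u + (-1 : ℝ) • v = u - v := by simp [sub_eq_add_neg]
  rw [h3] at h2
  norm_num at h1 h2
  linarith

theorem IsBestApproxSeq.isBestApproxSeqWith {m n : ℕ} {ξ : Matrix (Fin n) (Fin m) ℝ}
    {x : ℕ → Fin m → ℤ} {y : ℕ → Fin n → ℤ} (h : IsBestApproxSeq ξ x y) :
    IsBestApproxSeqWith ξ (fun v => ‖v‖) (fun v => ‖v‖) x y :=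
  ⟨h.nonzero, h.xStrictMono, h.lStrictAnti, h.best⟩

/-- Two best approximation vectors, congruent modulo `3`, differ in norm and in remainder by a
factor at least `2`. -/
theorem IsBestApproxSeqWith.doubling_of_modEq {m n : ℕ} {ξ : Matrix (Fin n) (Fin m) ℝ}
    {N₁ : (Fin m → ℝ) → ℝ} {N₂ : (Fin n → ℝ) → ℝ} (hN₁ : IsNorm N₁) (hN₂ : IsNorm N₂)
    {x : ℕ → Fin m → ℤ} {y : ℕ → Fin n → ℤ} (h : IsBestApproxSeqWith ξ N₁ N₂ x y)
    {a b : ℕ} (hab : a < b) (hx : ∀ j, (3 : ℤ) ∣ x b j - x a j)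
    (hy : ∀ j, (3 : ℤ) ∣ y b j - y a j) :
    2 * N₁ (fun j => (x a j : ℝ)) ≤ N₁ (fun j => (x b j : ℝ)) ∧
    2 * N₂ (ξ.mulVec (fun j => (x b j : ℝ)) - (fun k => (y b k : ℝ))) ≤
      N₂ (ξ.mulVec (fun j => (x a j : ℝ)) - (fun k => (y a k : ℝ))) := by
  choose u hu using hx
  choose v hv using hy
  have eu : (3 : ℝ) • (fun j => (u j : ℝ)) = (fun j => (x b j : ℝ)) - fun j => (x a j : ℝ) := by
    ext j
    have := hu j
    simp only [Pi.smul_apply, Pi.sub_apply, smul_eq_mul]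
    exact_mod_cast this.symm
  have ev : (3 : ℝ) • (fun j => (v j : ℝ)) = (fun j => (y b j : ℝ)) - fun j => (y a j : ℝ) := by
    ext j
    have := hv j
    simp only [Pi.smul_apply, Pi.sub_apply, smul_eq_mul]
    exact_mod_cast this.symm
  have er : (3 : ℝ) • (ξ.mulVec (fun j => (u j : ℝ)) - (fun k => (v k : ℝ))) =
      (ξ.mulVec (fun j => (x b j : ℝ)) - (fun k => (y b k : ℝ))) -
        (ξ.mulVec (fun j => (x a j : ℝ)) - (fun k => (y a k : ℝ))) := by
    rw [smul_sub, ← Matrix.mulVec_smul, eu, ev, Matrix.mulVec_sub]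
    abel
  have bX := hN₁.three_mul_le eu
  have bL := hN₂.three_mul_le er
  have hX := h.xStrictMono hab
  have hL := h.lStrictAnti hab
  have hLb := hN₂.1 (ξ.mulVec (fun j => (x b j : ℝ)) - (fun k => (y b k : ℝ)))
  have hXa := hN₁.1 (fun j => (x a j : ℝ))
  have u0 : u ≠ 0 := by
    rintro rfl
    have : x b = x a := by
      ext j
      have := hu j
      simp only [Pi.zero_apply, mul_zero] at this
      linarith
    simp [this] at hX
  obtain ⟨c, rfl⟩ : ∃ c, b = c + 1 := ⟨b - 1, by omega⟩
  dsimp only at hX hL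
  constructor
  · by_contra! hlt
    have h1 : N₁ (fun j => (u j : ℝ)) < N₁ (fun j => (x (a + 1) j : ℝ)) := by
      have := h.xStrictMono (Nat.lt_succ_self a)
      dsimp only [Nat.succ_eq_add_one] at this
      linarith
    have := h.best a u v u0 h1
    linarith
  · have := h.best c u v u0 (by linarith)
    have hc := h.lStrictAnti (Nat.lt_succ_self c)
    dsimp only [Nat.succ_eq_add_one] at hc
    linarith

/-- Norms and remainders of best approximation vectors grow and decay geometrically. -/
theorem IsBestApproxSeqWith.exists_doubling {m n : ℕ} {ξ : Matrix (Fin n) (Fin m) ℝ}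
    {N₁ : (Fin m → ℝ) → ℝ} {N₂ : (Fin n → ℝ) → ℝ} (hN₁ : IsNorm N₁) (hN₂ : IsNorm N₂)
    {x : ℕ → Fin m → ℤ} {y : ℕ → Fin n → ℤ} (h : IsBestApproxSeqWith ξ N₁ N₂ x y) :
    ∃ k : ℕ, ∀ i,
    2 * N₁ (fun j => (x i j : ℝ)) ≤ N₁ (fun j => (x (i + k) j : ℝ)) ∧
    2 * N₂ (ξ.mulVec (fun j => (x (i + k) j : ℝ)) - (fun l => (y (i + k) l : ℝ))) ≤
      N₂ (ξ.mulVec (fun j => (x i j : ℝ)) - (fun l => (y i l : ℝ))) := by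
  let R := (Fin m → ZMod 3) × (Fin n → ZMod 3)
  refine ⟨Fintype.card R, fun i => ?_⟩
  let f : Fin (Fintype.card R + 1) → R := fun t =>
    (fun j => (x (i + t) j : ZMod 3), fun j => (y (i + t) j : ZMod 3))
  obtain ⟨s, t, hlt, heq⟩ : ∃ s t, s < t ∧ f s = f t := by
    obtain ⟨s, t, hne, heq⟩ := Fintype.exists_ne_map_eq_of_card_lt f (by simp)
    rcases lt_or_gt_of_ne hne with hlt | hlt
    exacts [⟨s, t, hlt, heq⟩, ⟨t, s, hlt, heq.symm⟩]
  have key := h.doubling_of_modEq hN₁ hN₂ (a := i + s) (b := i + t)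
    (by simpa using hlt)
    (fun j => (ZMod.intCast_eq_intCast_iff_dvd_sub _ _ 3).1 (congrFun (congrArg Prod.fst heq) j))
    (fun j => (ZMod.intCast_eq_intCast_iff_dvd_sub _ _ 3).1 (congrFun (congrArg Prod.snd heq) j))
  have ht := t.is_lt
  have X1 := h.xStrictMono.monotone (show i ≤ i + s by omega)
  have X2 := h.xStrictMono.monotone (show i + t ≤ i + Fintype.card R by omega)
  have L1 := h.lStrictAnti.antitone (show i ≤ i + s by omega)
  have L2 := h.lStrictAnti.antitone (show i + t ≤ i + Fintype.card R by omega)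
  constructor <;> linarith [key.1, key.2]

/-- A common step over which a positive sequence grows by a factor `2` yields arbitrary powers. -/
theorem two_pow_mul_le {X : ℕ → ℝ} {k : ℕ} (hX : ∀ i, 2 * X i ≤ X (i + k)) (s i : ℕ) :
    2 ^ s * X i ≤ X (i + k * s) := by
  induction s with
  | zero => simp
  | succ s ih =>
    have := hX (i + k * s)
    rw [show i + k * (s + 1) = i + k * s + k by ring, pow_succ]
    linarith

theorem two_pow_mul_le_of_decay {L : ℕ → ℝ} {k : ℕ} (hL : ∀ i, 2 * L (i + k) ≤ L i) (s i : ℕ) :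
    2 ^ s * L (i + k * s) ≤ L i := by
  induction s with
  | zero => simp
  | succ s ih =>
    have := mul_le_mul_of_nonneg_left (hL (i + k * s)) (show (0 : ℝ) ≤ 2 ^ s by positivity)
    rw [show i + k * (s + 1) = i + k * s + k by ring, pow_succ]
    linarith

theorem le_pow_mul_of_le_mul {X : ℕ → ℝ} {M : ℝ} (hM : 0 ≤ M) (h : ∀ i, X (i + 1) ≤ M * X i)
    (t i : ℕ) : X (i + t) ≤ M ^ t * X i := by
  induction t with
  | zero => simp
  | succ t ih =>
    calc X (i + t + 1) ≤ M * X (i + t) := h _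
      _ ≤ M * (M ^ t * X i) := mul_le_mul_of_nonneg_left ih hM
      _ = _ := by ring

theorem le_pow_mul_of_le_mul_succ {L : ℕ → ℝ} {M : ℝ} (hM : 0 ≤ M) (h : ∀ i, L i ≤ M * L (i + 1))
    (t i : ℕ) : L i ≤ M ^ t * L (i + t) := by
  induction t with
  | zero => simp
  | succ t ih =>
    calc L i ≤ M ^ t * L (i + t) := ih
      _ ≤ M ^ t * (M * L (i + t + 1)) := mul_le_mul_of_nonneg_left (h _) (pow_nonneg hM t)
      _ = _ := by rw [pow_succ, mul_assoc, add_assoc]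

/-- The ratios of the growing sequence of norms stay bounded when passing to a comparable sequence
of approximations. -/
theorem bounded_growth_transfer {X L X' L' : ℕ → ℝ} {k : ℕ} {K : ℝ} (hK : 1 ≤ K)
    (pX : ∀ i, 0 < X i) (pX' : ∀ i, 0 < X' i) (pL' : ∀ i, 0 < L' i) (mX' : Monotone X')
    (dX : ∀ i, 2 * X i ≤ X (i + k)) (dL : ∀ i, 2 * L (i + k) ≤ L i)
    (hA : ∀ i j, K * X' j < X (i + 1) → L i ≤ K * L' j)
    (hB : ∀ i j, K * X i < X' (j + 1) → L' j ≤ K * L i)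
    (h : ∃ M : ℝ, ∀ i, X (i + 1) / X i ≤ M) : ∃ M : ℝ, ∀ i, X' (i + 1) / X' i ≤ M := by
  obtain ⟨M, hM⟩ := h
  have M0 : 0 ≤ M := (div_pos (pX 1) (pX 0)).le.trans (hM 0)
  have hM' : ∀ i, X (i + 1) ≤ M * X i := fun i => (div_le_iff₀ (pX i)).1 (hM i)
  obtain ⟨s, hs⟩ := pow_unbounded_of_one_lt (K ^ 2) (one_lt_two : (1 : ℝ) < 2)
  have ex : ∀ T, ∃ i, T < X (i + 1) := by
    intro T
    obtain ⟨r, hr⟩ := pow_unbounded_of_one_lt (T / X 1) (one_lt_two : (1 : ℝ) < 2)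
    refine ⟨k * r, ?_⟩
    have := two_pow_mul_le dX r 1
    rw [div_lt_iff₀ (pX 1)] at hr
    rw [add_comm]
    linarith
  refine ⟨K * (M ^ (k * s) * max K (X 0 / X' 0)), fun j => ?_⟩
  rw [div_le_iff₀ (pX' j)]
  classical
  obtain ⟨i, hi, himin⟩ : ∃ i, K * X' j < X (i + 1) ∧ ∀ l < i, ¬ K * X' j < X (l + 1) :=
    ⟨Nat.find (ex _), Nat.find_spec (ex _), fun l hl => Nat.find_min (ex _) hl⟩
  have Xi : X i ≤ max K (X 0 / X' 0) * X' j := by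
    rcases i with _ | l
    · calc X 0 = X 0 / X' 0 * X' 0 := (div_mul_cancel₀ _ (pX' 0).ne').symm
        _ ≤ X 0 / X' 0 * X' j :=
          mul_le_mul_of_nonneg_left (mX' (Nat.zero_le j)) (div_pos (pX 0) (pX' 0)).le
        _ ≤ _ := mul_le_mul_of_nonneg_right (le_max_right _ _) (pX' j).le
    · exact (not_lt.1 (himin l (Nat.lt_succ_self l))).trans
        (mul_le_mul_of_nonneg_right (le_max_left _ _) (pX' j).le)
  have far : X' (j + 1) ≤ K * X (i + k * s) := by
    by_contra! hlt
    have h1 := mul_le_mul_of_nonneg_left (hB _ _ hlt) (show (0 : ℝ) ≤ 2 ^ s by positivity)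
    have h2 := mul_le_mul_of_nonneg_left ((two_pow_mul_le_of_decay dL s i).trans (hA i j hi))
      (zero_le_one.trans hK)
    have h3 := mul_lt_mul_of_pos_right hs (pL' j)
    linarith
  calc X' (j + 1) ≤ K * X (i + k * s) := far
    _ ≤ K * (M ^ (k * s) * X i) :=
      mul_le_mul_of_nonneg_left (le_pow_mul_of_le_mul M0 hM' _ _) (by linarith)
    _ ≤ K * (M ^ (k * s) * (max K (X 0 / X' 0) * X' j)) := by gcongr
    _ = _ := by ring

/-- The ratios of the decaying sequence of remainders stay bounded when passing to a comparable
sequence of approximations. -/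
theorem bounded_decay_transfer {X L X' L' : ℕ → ℝ} {k : ℕ} {K : ℝ} (hK : 1 ≤ K)
    (pX : ∀ i, 0 < X i) (pL : ∀ i, 0 < L i) (pL' : ∀ i, 0 < L' i) (mX : StrictMono X)
    (mL' : Antitone L')
    (dX : ∀ i, 2 * X i ≤ X (i + k)) (dL : ∀ i, 2 * L (i + k) ≤ L i)
    (hA : ∀ i j, K * X' j < X (i + 1) → L i ≤ K * L' j)
    (hB : ∀ i j, K * X i < X' (j + 1) → L' j ≤ K * L i)
    (h : ∃ M : ℝ, ∀ i, L i / L (i + 1) ≤ M) : ∃ M : ℝ, ∀ i, L' i / L' (i + 1) ≤ M := by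
  obtain ⟨M, hM⟩ := h
  have M0 : 0 ≤ M := (div_pos (pL 0) (pL 1)).le.trans (hM 0)
  have hM' : ∀ i, L i ≤ M * L (i + 1) := fun i => (div_le_iff₀ (pL _)).1 (hM i)
  have K0 : 0 < K := by linarith
  obtain ⟨s, hs⟩ := pow_unbounded_of_one_lt (K ^ 2) (one_lt_two : (1 : ℝ) < 2)
  have ex : ∀ T, 0 < T → ∃ i, K * L i < T := by
    intro T hT
    obtain ⟨r, hr⟩ := pow_unbounded_of_one_lt (K * L 0 / T) (one_lt_two : (1 : ℝ) < 2)
    refine ⟨0 + k * r, ?_⟩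
    have h1 := mul_le_mul_of_nonneg_left (two_pow_mul_le_of_decay dL r 0) K0.le
    rw [div_lt_iff₀ hT] at hr
    refine lt_of_mul_lt_mul_left ?_ (show (0 : ℝ) ≤ 2 ^ r by positivity)
    linarith
  refine ⟨max (K * M) (L' 0 / L 0) * (M ^ (k * s) * K), fun j => ?_⟩
  rw [div_le_iff₀ (pL' _)]
  classical
  obtain ⟨i, hi, himin⟩ : ∃ i, K * L i < L' j ∧ ∀ l < i, ¬ K * L l < L' j :=
    ⟨Nat.find (ex _ (pL' j)), Nat.find_spec (ex _ (pL' j)),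
      fun l hl => Nat.find_min (ex _ (pL' j)) hl⟩
  have Li : L' j ≤ max (K * M) (L' 0 / L 0) * L i := by
    rcases i with _ | l
    · calc L' j ≤ L' 0 := mL' (Nat.zero_le j)
        _ = L' 0 / L 0 * L 0 := (div_mul_cancel₀ _ (pL 0).ne').symm
        _ ≤ _ := mul_le_mul_of_nonneg_right (le_max_right _ _) (pL 0).le
    · calc L' j ≤ K * L l := not_lt.1 (himin l (Nat.lt_succ_self l))
        _ ≤ K * (M * L (l + 1)) := mul_le_mul_of_nonneg_left (hM' l) K0.le
        _ = K * M * L (l + 1) := by ring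
        _ ≤ _ := mul_le_mul_of_nonneg_right (le_max_left _ _) (pL _).le
  have far : X' (j + 1) ≤ K * X i := by
    by_contra! hlt
    exact absurd (hB _ _ hlt) (not_le.2 hi)
  have next : L (i + k * s) ≤ K * L' (j + 1) := by
    apply hA
    have h1 := mul_le_mul_of_nonneg_left far K0.le
    have h2 := two_pow_mul_le dX s i
    have h3 := mul_lt_mul_of_pos_right hs (pX i)
    have h4 := mX (Nat.lt_succ_self (i + k * s))
    rw [Nat.succ_eq_add_one] at h4
    linarith
  have C0 : 0 ≤ max (K * M) (L' 0 / L 0) := (mul_nonneg K0.le M0).trans (le_max_left _ _)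
  calc L' j ≤ max (K * M) (L' 0 / L 0) * L i := Li
    _ ≤ max (K * M) (L' 0 / L 0) * (M ^ (k * s) * L (i + k * s)) :=
      mul_le_mul_of_nonneg_left (le_pow_mul_of_le_mul_succ M0 hM' _ _) C0
    _ ≤ max (K * M) (L' 0 / L 0) * (M ^ (k * s) * (K * L' (j + 1))) := by gcongr
    _ = _ := by ring

theorem IsBestApproxSeqWith.norm_pos {m n : ℕ} {ξ : Matrix (Fin n) (Fin m) ℝ}
    {N₁ : (Fin m → ℝ) → ℝ} {N₂ : (Fin n → ℝ) → ℝ} (hN₁ : IsNorm N₁)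
    {x : ℕ → Fin m → ℤ} {y : ℕ → Fin n → ℤ} (h : IsBestApproxSeqWith ξ N₁ N₂ x y) (i : ℕ) :
    0 < N₁ (fun j => (x i j : ℝ)) := by
  refine lt_of_le_of_ne (hN₁.1 _) fun h0 => h.nonzero i ?_
  ext j
  have := congrFun ((hN₁.2.1 _).1 h0.symm) j
  simpa using this

theorem IsBestApproxSeqWith.remainder_pos {m n : ℕ} {ξ : Matrix (Fin n) (Fin m) ℝ}
    {N₁ : (Fin m → ℝ) → ℝ} {N₂ : (Fin n → ℝ) → ℝ} (hN₂ : IsNorm N₂)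
    {x : ℕ → Fin m → ℤ} {y : ℕ → Fin n → ℤ} (h : IsBestApproxSeqWith ξ N₁ N₂ x y) (i : ℕ) :
    0 < N₂ (ξ.mulVec (fun j => (x i j : ℝ)) - (fun k => (y i k : ℝ))) :=
  (hN₂.1 _).trans_lt (h.lStrictAnti (Nat.lt_succ_self i))

/-- Boundedness of the ratios passes from one pair of norms to any comparable pair. -/
theorem IsBestApproxSeqWith.bounded_ratios_transfer {m n : ℕ} {ξ : Matrix (Fin n) (Fin m) ℝ}
    {N₁ N₁' : (Fin m → ℝ) → ℝ} {N₂ N₂' : (Fin n → ℝ) → ℝ}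
    (hN₁ : IsNorm N₁) (hN₂ : IsNorm N₂) (hN₁' : IsNorm N₁') (hN₂' : IsNorm N₂')
    {K : ℝ} (hK : 1 ≤ K)
    (c₁ : ∀ v, N₁ v ≤ K * N₁' v) (c₁' : ∀ v, N₁' v ≤ K * N₁ v)
    (c₂ : ∀ v, N₂ v ≤ K * N₂' v) (c₂' : ∀ v, N₂' v ≤ K * N₂ v)
    {x x' : ℕ → Fin m → ℤ} {y y' : ℕ → Fin n → ℤ}
    (h : IsBestApproxSeqWith ξ N₁ N₂ x y) (h' : IsBestApproxSeqWith ξ N₁' N₂' x' y') :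
    ((∃ M : ℝ, ∀ i : ℕ,
        N₁ (fun j => (x (i + 1) j : ℝ)) / N₁ (fun j => (x i j : ℝ)) ≤ M) →
      (∃ M : ℝ, ∀ i : ℕ,
        N₁' (fun j => (x' (i + 1) j : ℝ)) / N₁' (fun j => (x' i j : ℝ)) ≤ M)) ∧
    ((∃ M : ℝ, ∀ i : ℕ,
        N₂ (ξ.mulVec (fun j => (x i j : ℝ)) - (fun k => (y i k : ℝ))) /
          N₂ (ξ.mulVec (fun j => (x (i + 1) j : ℝ)) - (fun k => (y (i + 1) k : ℝ))) ≤ M) →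
      (∃ M : ℝ, ∀ i : ℕ,
        N₂' (ξ.mulVec (fun j => (x' i j : ℝ)) - (fun k => (y' i k : ℝ))) /
          N₂' (ξ.mulVec (fun j => (x' (i + 1) j : ℝ)) - (fun k => (y' (i + 1) k : ℝ)))
            ≤ M)) := by
  obtain ⟨k, hk⟩ := h.exists_doubling hN₁ hN₂
  have hA : ∀ i j, K * N₁' (fun l => (x' j l : ℝ)) < N₁ (fun l => (x (i + 1) l : ℝ)) →
      N₂ (ξ.mulVec (fun l => (x i l : ℝ)) - (fun l => (y i l : ℝ))) ≤
        K * N₂' (ξ.mulVec (fun l => (x' j l : ℝ)) - (fun l => (y' j l : ℝ))) := fun i j hij =>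
    (h.best i (x' j) (y' j) (h'.nonzero j) ((c₁ _).trans_lt hij)).trans (c₂ _)
  have hB : ∀ i j, K * N₁ (fun l => (x i l : ℝ)) < N₁' (fun l => (x' (j + 1) l : ℝ)) →
      N₂' (ξ.mulVec (fun l => (x' j l : ℝ)) - (fun l => (y' j l : ℝ))) ≤
        K * N₂ (ξ.mulVec (fun l => (x i l : ℝ)) - (fun l => (y i l : ℝ))) := fun i j hij =>
    (h'.best j (x i) (y i) (h.nonzero i) ((c₁' _).trans_lt hij)).trans (c₂' _)
  exact ⟨bounded_growth_transfer hK (h.norm_pos hN₁) (h'.norm_pos hN₁') (h'.remainder_pos hN₂')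
      h'.xStrictMono.monotone (fun i => (hk i).1) (fun i => (hk i).2) hA hB,
    bounded_decay_transfer hK (h.norm_pos hN₁) (h.remainder_pos hN₂) (h'.remainder_pos hN₂')
      h.xStrictMono h'.lStrictAnti.antitone (fun i => (hk i).1) (fun i => (hk i).2) hA hB⟩

/-- Boundedness of the ratios `X_{i+1}/X_i` and `L_i/L_{i+1}` of the
best approximation sequences does not depend on the choice of the pair of norms. -/
theorem stmt_0 (m n : ℕ) (hm : 1 ≤ m) (hn : 1 ≤ n)
    (ξ : Matrix (Fin n) (Fin m) ℝ) (hirr : TotallyIrrational ξ)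
    (N₁ : (Fin m → ℝ) → ℝ) (N₂ : (Fin n → ℝ) → ℝ)
    (hN₁ : IsNorm N₁) (hN₂ : IsNorm N₂)
    (x : ℕ → Fin m → ℤ) (y : ℕ → Fin n → ℤ)
    (hxy : IsBestApproxSeq ξ x y)
    (x' : ℕ → Fin m → ℤ) (y' : ℕ → Fin n → ℤ)
    (hxy' : IsBestApproxSeqWith ξ N₁ N₂ x' y') :
    ((∃ M : ℝ, ∀ i : ℕ, Xval x (i + 1) / Xval x i ≤ M) ↔
      (∃ M : ℝ, ∀ i : ℕ,
        N₁ (fun j => (x' (i + 1) j : ℝ)) / N₁ (fun j => (x' i j : ℝ)) ≤ M)) ∧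
    ((∃ M : ℝ, ∀ i : ℕ, Lval ξ x y i / Lval ξ x y (i + 1) ≤ M) ↔
      (∃ M : ℝ, ∀ i : ℕ,
        N₂ (ξ.mulVec (fun j => (x' i j : ℝ)) - (fun k => (y' i k : ℝ))) /
          N₂ (ξ.mulVec (fun j => (x' (i + 1) j : ℝ)) - (fun k => (y' (i + 1) k : ℝ)))
            ≤ M)) := by
  obtain ⟨K₁, hK₁, e₁⟩ := hN₁.exists_equiv_sup
  obtain ⟨K₂, hK₂, e₂⟩ := hN₂.exists_equiv_sup
  have hK : 1 ≤ max K₁ K₂ := hK₁.trans (le_max_left _ _)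
  have c₁ : ∀ v, ‖v‖ ≤ max K₁ K₂ * N₁ v := fun v => (e₁ v).2.trans
    (mul_le_mul_of_nonneg_right (le_max_left _ _) (hN₁.1 v))
  have c₁' : ∀ v, N₁ v ≤ max K₁ K₂ * ‖v‖ := fun v => (e₁ v).1.trans
    (mul_le_mul_of_nonneg_right (le_max_left _ _) (norm_nonneg v))
  have c₂ : ∀ v, ‖v‖ ≤ max K₁ K₂ * N₂ v := fun v => (e₂ v).2.trans
    (mul_le_mul_of_nonneg_right (le_max_right _ _) (hN₂.1 v))
  have c₂' : ∀ v, N₂ v ≤ max K₁ K₂ * ‖v‖ := fun v => (e₂ v).1.trans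
    (mul_le_mul_of_nonneg_right (le_max_right _ _) (norm_nonneg v))
  have h := hxy.isBestApproxSeqWith
  have there := h.bounded_ratios_transfer (isNorm_sup m) (isNorm_sup n) hN₁ hN₂ hK
    c₁ c₁' c₂ c₂' hxy'
  have back := hxy'.bounded_ratios_transfer hN₁ hN₂ (isNorm_sup m) (isNorm_sup n) hK
    c₁' c₁ c₂' c₂ h
  exact ⟨⟨there.1, back.1⟩, ⟨there.2, back.2⟩⟩
end

section
/- Let m, n ≥ 1 and let ξ ∈ ℝ^{n×m} be totally irrational with best approximation sequences (X_i), (L_i). If ξ is badly approximable (Property (A)), then both sup_{i≥1} X_{i+1}/X_i < ∞ (Property (B)) and sup_{i≥1} L_i/L_{i+1} < ∞ (Property (C)). -/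
open Filter

/-- Dirichlet's theorem for systems of linear forms, by the pigeonhole principle. -/
theorem exists_int_approx_of_pow_lt {m n : ℕ} (ξ : Matrix (Fin n) (Fin m) ℝ) {N K : ℕ}
    (hK : 0 < K) (h : K ^ n < N ^ m) :
    ∃ (u : Fin m → ℤ) (v : Fin n → ℤ), u ≠ 0 ∧ (∀ j, |(u j : ℝ)| ≤ (N : ℝ) - 1) ∧
      ‖(ξ.mulVec (fun j => (u j : ℝ)) - (fun k => (v k : ℝ)))‖ < 1 / K := by
  have hK' : (0 : ℝ) < K := by exact_mod_cast hK
  let g : (Fin m → Fin N) → Fin n → ℝ := fun a => ξ.mulVec (fun j => ((a j : ℕ) : ℝ))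
  have hlt : ∀ a k, ⌊(K : ℝ) * Int.fract (g a k)⌋₊ < K := fun a k => by
    rw [Nat.floor_lt (mul_nonneg hK'.le (Int.fract_nonneg _))]
    exact mul_lt_of_lt_one_right hK' (Int.fract_lt_one _)
  let f : (Fin m → Fin N) → (Fin n → Fin K) := fun a k => ⟨_, hlt a k⟩
  obtain ⟨a, b, hab, hf⟩ := Fintype.exists_ne_map_eq_of_card_lt f (by simpa using h)
  refine ⟨fun j => (a j : ℤ) - (b j : ℤ), fun k => ⌊g a k⌋ - ⌊g b k⌋, ?_, ?_, ?_⟩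
  · intro h0
    refine hab (funext fun j => Fin.ext ?_)
    have := congrFun h0 j
    simp only [Pi.zero_apply] at this
    omega
  · intro j
    have ha : ((a j : ℕ) : ℝ) + 1 ≤ N := by exact_mod_cast (a j).2
    have hb : ((b j : ℕ) : ℝ) + 1 ≤ N := by exact_mod_cast (b j).2
    have ha0 : (0 : ℝ) ≤ ((a j : ℕ) : ℝ) := Nat.cast_nonneg _
    have hb0 : (0 : ℝ) ≤ ((b j : ℕ) : ℝ) := Nat.cast_nonneg _
    push_cast
    rw [abs_le]
    constructor <;> linarith
  · rw [pi_norm_lt_iff (by positivity)]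
    intro k
    have hfk : ⌊(K : ℝ) * Int.fract (g a k)⌋₊ = ⌊(K : ℝ) * Int.fract (g b k)⌋₊ :=
      congrArg Fin.val (congrFun hf k)
    have hsub : ξ.mulVec (fun j => (((a j : ℤ) - (b j : ℤ) : ℤ) : ℝ)) k = g a k - g b k := by
      have : (fun j => (((a j : ℤ) - (b j : ℤ) : ℤ) : ℝ)) =
          (fun j => ((a j : ℕ) : ℝ)) - (fun j => ((b j : ℕ) : ℝ)) := by
        ext j; simp
      rw [this, Matrix.mulVec_sub]
      rfl
    have hdiff : g a k - g b k - ((⌊g a k⌋ - ⌊g b k⌋ : ℤ) : ℝ) =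
        Int.fract (g a k) - Int.fract (g b k) := by
      simp only [Int.fract]; push_cast; ring
    rw [Pi.sub_apply, hsub, hdiff, Real.norm_eq_abs, lt_div_iff₀ hK', ← abs_of_pos hK', ← abs_mul]
    have ha1 := Nat.floor_le (mul_nonneg hK'.le (Int.fract_nonneg (g a k)))
    have hb1 := Nat.floor_le (mul_nonneg hK'.le (Int.fract_nonneg (g b k)))
    have ha2 := Nat.lt_floor_add_one ((K : ℝ) * Int.fract (g a k))
    have hb2 := Nat.lt_floor_add_one ((K : ℝ) * Int.fract (g b k))
    rw [hfk] at ha1 ha2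
    rw [abs_lt]
    constructor <;> linarith

theorem Xval_pos {m n : ℕ} {ξ : Matrix (Fin n) (Fin m) ℝ} {x : ℕ → Fin m → ℤ}
    {y : ℕ → Fin n → ℤ} (hxy : IsBestApproxSeq ξ x y) (i : ℕ) : 0 < Xval x i := by
  have h := hxy.xStrictMono.monotone (Nat.zero_le i)
  rw [hxy.first] at h
  linarith

theorem Lval_pos {m n : ℕ} {ξ : Matrix (Fin n) (Fin m) ℝ} {x : ℕ → Fin m → ℤ}
    {y : ℕ → Fin n → ℤ} (hxy : IsBestApproxSeq ξ x y) (i : ℕ) : 0 < Lval ξ x y i :=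
  (norm_nonneg _).trans_lt (hxy.lStrictAnti (Nat.lt_succ_self i))

/-- Minkowski's bound `X_{i+1}^m L_i^n ≪ 1` for consecutive best approximations. -/
theorem Xval_succ_pow_mul_Lval_pow_le {m n : ℕ} (hm : 1 ≤ m) {ξ : Matrix (Fin n) (Fin m) ℝ}
    {x : ℕ → Fin m → ℤ} {y : ℕ → Fin n → ℤ} (hxy : IsBestApproxSeq ξ x y) (i : ℕ) :
    Xval x (i + 1) ^ m * Lval ξ x y i ^ n ≤ 2 ^ n := by
  have hX := Xval_pos hxy (i + 1)
  have hL := Lval_pos hxy i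
  set N := ⌈Xval x (i + 1)⌉₊ with hN
  have key : ∀ K : ℕ, 0 < K → K ^ n < N ^ m → Lval ξ x y i < 1 / K := by
    intro K hK h
    obtain ⟨u, v, hu, hu', hv⟩ := exists_int_approx_of_pow_lt ξ hK h
    refine (hxy.best i u v hu ?_).trans_lt hv
    rw [pi_norm_lt_iff hX]
    intro j
    have := Nat.ceil_lt_add_one hX.le
    rw [Real.norm_eq_abs]
    linarith [hu' j]
  have hN2 : 1 < N := by
    rw [hN, Nat.lt_ceil]
    have h := hxy.xStrictMono (Nat.succ_pos i)
    rw [hxy.first] at h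
    simpa using h
  have hL1 : Lval ξ x y i < 1 := by
    simpa using key 1 one_pos (by simpa using Nat.one_lt_pow (by omega) hN2)
  set K := ⌈1 / Lval ξ x y i⌉₊ with hKdef
  have hK : 0 < K := Nat.ceil_pos.2 (by positivity)
  have hK' : (0 : ℝ) < K := by exact_mod_cast hK
  have hpow : N ^ m ≤ K ^ n := by
    by_contra! h
    have h1 := key K hK h
    have h2 : 1 / Lval ξ x y i ≤ K := Nat.le_ceil _
    rw [lt_div_iff₀ hK'] at h1
    rw [div_le_iff₀ hL] at h2
    linarith
  have hKL : (K : ℝ) * Lval ξ x y i ≤ 2 := by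
    have h2 := Nat.ceil_lt_add_one (one_div_pos.2 hL).le
    rw [← hKdef] at h2
    have h3 := mul_le_mul_of_nonneg_right h2.le hL.le
    rw [add_mul, one_div_mul_cancel hL.ne'] at h3
    linarith
  calc Xval x (i + 1) ^ m * Lval ξ x y i ^ n
      ≤ (N : ℝ) ^ m * Lval ξ x y i ^ n := by gcongr; exact Nat.le_ceil _
    _ ≤ (K : ℝ) ^ n * Lval ξ x y i ^ n := by gcongr; exact_mod_cast hpow
    _ = (K * Lval ξ x y i) ^ n := (mul_pow _ _ _).symm
    _ ≤ 2 ^ n := by gcongr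

theorem le_max_one_of_pow_le {r M : ℝ} {k : ℕ} (hk : 1 ≤ k) (h : r ^ k ≤ M) : r ≤ max 1 M := by
  rcases le_total r 1 with hr | hr
  · exact hr.trans (le_max_left _ _)
  · exact ((le_self_pow₀ hr (by omega)).trans h).trans (le_max_right _ _)

/-- If `ξ` is badly approximable (A), then both (B) and (C) hold. -/
theorem stmt_1 (m n : ℕ) (hm : 1 ≤ m) (hn : 1 ≤ n)
    (ξ : Matrix (Fin n) (Fin m) ℝ) (hirr : TotallyIrrational ξ)
    (x : ℕ → Fin m → ℤ) (y : ℕ → Fin n → ℤ) (hxy : IsBestApproxSeq ξ x y)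
    (hA : PropA ξ) :
    PropB x ∧ PropC ξ x y := by
  obtain ⟨c, hc, hA⟩ := hA
  have hX := Xval_pos hxy
  have hL := Lval_pos hxy
  have hup := Xval_succ_pow_mul_Lval_pow_le hm hxy
  have hlow : ∀ i, c ≤ Xval x i ^ m * Lval ξ x y i ^ n := fun i => hA _ _ (hxy.nonzero i)
  refine ⟨⟨max 1 (2 ^ n / c), fun i => le_max_one_of_pow_le hm ?_⟩,
    ⟨max 1 (2 ^ n / c), fun i => le_max_one_of_pow_le hn ?_⟩⟩
  · calc (Xval x (i + 1) / Xval x i) ^ m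
        = (Xval x (i + 1) ^ m * Lval ξ x y i ^ n) / (Xval x i ^ m * Lval ξ x y i ^ n) := by
          rw [mul_div_mul_right _ _ (pow_pos (hL i) n).ne', div_pow]
      _ ≤ 2 ^ n / c := div_le_div₀ (by positivity) (hup i) hc (hlow i)
  · calc (Lval ξ x y i / Lval ξ x y (i + 1)) ^ n
        = (Xval x (i + 1) ^ m * Lval ξ x y i ^ n) /
            (Xval x (i + 1) ^ m * Lval ξ x y (i + 1) ^ n) := by
          rw [mul_div_mul_left _ _ (pow_pos (hX (i + 1)) m).ne', div_pow]
      _ ≤ 2 ^ n / c := div_le_div₀ (by positivity) (hup i) hc (hlow (i + 1))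
end

section
/- Let n = 1 and m ≥ 1, and let ξ ∈ ℝ^{1×m} be totally irrational with best approximation sequences (X_i), (L_i). If sup_{i≥1} L_i/L_{i+1} < ∞ (Property (C)), then ξ is badly approximable (Property (A)); in particular, for n = 1 Properties (A) and (C) are equivalent. -/
open Filter

/-- The sup norm of an integer vector is a natural number. -/
theorem exists_nat_norm_intCast {m : ℕ} (u : Fin m → ℤ) :
    ∃ k : ℕ, ‖(fun j => (u j : ℝ))‖ = k := by
  rcases isEmpty_or_nonempty (Fin m) with h | h
  · exact ⟨0, by simp [Subsingleton.elim (fun j => (u j : ℝ)) 0]⟩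
  · obtain ⟨j, hj⟩ := Finite.exists_max fun j => ‖(u j : ℝ)‖
    refine ⟨(u j).natAbs, ?_⟩
    rw [Nat.cast_natAbs, Int.cast_abs]
    exact le_antisymm ((pi_norm_le_iff_of_nonneg (abs_nonneg _)).2 hj)
      (norm_le_pi_norm (fun j => (u j : ℝ)) j)

theorem norm_fin_one (f : Fin 1 → ℝ) : ‖f‖ = |f 0| := by
  refine le_antisymm ((pi_norm_le_iff_of_nonneg (abs_nonneg _)).2 fun k => ?_)
    (norm_le_pi_norm f 0)
  rw [Subsingleton.elim k 0, Real.norm_eq_abs]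

/-- Dirichlet's theorem for one linear form in `m` variables. -/
theorem exists_linearForm_near_int {m : ℕ} (hm : 1 ≤ m) (a : Fin m → ℝ) {N : ℕ} (hN : 1 ≤ N) :
    ∃ (u : Fin m → ℤ) (v : ℤ), u ≠ 0 ∧ (∀ j, |(u j : ℝ)| ≤ N) ∧
      |∑ j, a j * u j - v| ≤ 1 / (N : ℝ) ^ m := by
  have hK : (0 : ℝ) < (N : ℝ) ^ m := by positivity
  let g : (Fin m → Fin (N + 1)) → ℝ := fun t => ∑ j, a j * ((t j : ℕ) : ℝ)
  have hmaps : ∀ t ∈ (Finset.univ : Finset (Fin m → Fin (N + 1))),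
      ⌊Int.fract (g t) * (N : ℝ) ^ m⌋₊ ∈ Finset.range (N ^ m) := by
    intro t _
    rw [Finset.mem_range, Nat.floor_lt (by have := Int.fract_nonneg (g t); positivity)]
    push_cast
    have := Int.fract_lt_one (g t)
    nlinarith
  have hcard : (Finset.range (N ^ m)).card
      < (Finset.univ : Finset (Fin m → Fin (N + 1))).card := by
    simpa using Nat.pow_lt_pow_left (Nat.lt_succ_self N) (by omega)
  obtain ⟨s, -, t, -, hst, heq⟩ := Finset.exists_ne_map_eq_of_card_lt_of_maps_to hcard hmaps
  refine ⟨fun j => ((s j : ℕ) : ℤ) - ((t j : ℕ) : ℤ), ⌊g s⌋ - ⌊g t⌋, ?_, ?_, ?_⟩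
  · intro h
    apply hst
    ext j
    have := congrFun h j
    simp only [Pi.zero_apply] at this
    omega
  · intro j
    have h1 : ((s j : ℕ) : ℝ) ≤ N := by exact_mod_cast Nat.lt_succ_iff.1 (s j).2
    have h2 : ((t j : ℕ) : ℝ) ≤ N := by exact_mod_cast Nat.lt_succ_iff.1 (t j).2
    have h3 : (0 : ℝ) ≤ ((s j : ℕ) : ℝ) := by positivity
    have h4 : (0 : ℝ) ≤ ((t j : ℕ) : ℝ) := by positivity
    push_cast
    rw [abs_le]
    constructor <;> linarith
  · have hsum : ∑ j, a j * (((((s j : ℕ) : ℤ) - ((t j : ℕ) : ℤ) : ℤ)) : ℝ) = g s - g t := by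
      simp only [g]
      rw [← Finset.sum_sub_distrib]
      refine Finset.sum_congr rfl fun j _ => ?_
      push_cast
      ring
    rw [hsum]
    have hdiff : g s - g t - ((⌊g s⌋ - ⌊g t⌋ : ℤ) : ℝ) = Int.fract (g s) - Int.fract (g t) := by
      simp only [Int.fract]
      push_cast
      ring
    rw [hdiff, le_div_iff₀ hK]
    have hs0 : 0 ≤ Int.fract (g s) * (N : ℝ) ^ m := by
      have := Int.fract_nonneg (g s); positivity
    have ht0 : 0 ≤ Int.fract (g t) * (N : ℝ) ^ m := by
      have := Int.fract_nonneg (g t); positivity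
    have hs1 := Nat.floor_le hs0
    have hs2 := Nat.lt_floor_add_one (Int.fract (g s) * (N : ℝ) ^ m)
    have ht1 := Nat.floor_le ht0
    have ht2 := Nat.lt_floor_add_one (Int.fract (g t) * (N : ℝ) ^ m)
    rw [heq] at hs1 hs2
    nth_rw 1 [← abs_of_pos hK]
    rw [← abs_mul, sub_mul, abs_le]
    constructor <;> linarith

/-- A vector in the real span of a subset `S` of an additive group `Λ` can be rounded to an
element of `Λ` in the span, with an error controlled by any seminorm bounded on `S`. -/
theorem exists_round_mem_span {E : Type*} [AddCommGroup E] [Module ℝ E] [FiniteDimensional ℝ E]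
    (Λ : AddSubgroup E) {S : Set E} (hS : S ⊆ Λ) {v : E} (hv : v ∈ Submodule.span ℝ S) :
    ∃ w ∈ Λ, w ∈ Submodule.span ℝ S ∧ ∀ (p : Seminorm ℝ E) (A : ℝ), 0 ≤ A → (∀ s ∈ S, p s ≤ A) →
      p (v - w) ≤ Module.finrank ℝ E * A := by
  obtain ⟨b, hbS, hspan, hli⟩ := exists_linearIndependent ℝ S
  have : Fintype b := hli.setFinite.fintype
  rw [← hspan] at hv
  rw [show b = Set.range ((↑) : b → E) by simp] at hv
  obtain ⟨c, hc⟩ := (Submodule.mem_span_range_iff_exists_fun ℝ).1 hv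
  refine ⟨∑ i, ⌊c i⌋ • (i : E), Λ.sum_mem fun i _ => Λ.zsmul_mem (hS (hbS i.2)) _,
    Submodule.sum_mem _ fun i _ => zsmul_mem (Submodule.subset_span (hbS i.2)) _, ?_⟩
  intro p A hA hp
  have hdiff : v - ∑ i, ⌊c i⌋ • (i : E) = ∑ i, Int.fract (c i) • (i : E) := by
    rw [← hc, ← Finset.sum_sub_distrib]
    refine Finset.sum_congr rfl fun i _ => ?_
    rw [Int.fract, sub_smul, Int.cast_smul_eq_zsmul]
  rw [hdiff]
  calc p (∑ i, Int.fract (c i) • (i : E)) ≤ ∑ i, p (Int.fract (c i) • (i : E)) :=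
        Finset.le_sum_of_subadditive p (map_zero p).le (map_add_le_add p) _ _
    _ ≤ ∑ _i : b, A := by
        refine Finset.sum_le_sum fun i _ => ?_
        rw [map_smul_eq_mul, Real.norm_eq_abs, abs_of_nonneg (Int.fract_nonneg _)]
        have h1 := hp i (hbS i.2)
        have h2 := apply_nonneg p (i : E)
        nlinarith [Int.fract_nonneg (c i), Int.fract_lt_one (c i)]
    _ = Fintype.card b * A := by simp
    _ ≤ Module.finrank ℝ E * A := by
        gcongr
        exact hli.fintype_card_le_finrank

/-- Given a set `S` of lattice vectors, and lattice vectors `x ∈ span S`, `z ∉ span S` such that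
`F z` is not much larger than `F x`, the vector `z` can be translated by a lattice vector of
`span S` so that `F` becomes as small as it is on `S`. -/
theorem exists_notMem_span_small {E : Type*} [AddCommGroup E] [Module ℝ E]
    [FiniteDimensional ℝ E] (Λ : AddSubgroup E) {S : Set E} (hS : S ⊆ Λ) (p : Seminorm ℝ E)
    (F : E →ₗ[ℝ] ℝ) {A B M : ℝ} (hA : 0 ≤ A) (hB : 0 ≤ B) (hpS : ∀ s ∈ S, p s ≤ A)
    (hFS : ∀ s ∈ S, |F s| ≤ B) {x z : E} (hx : x ∈ Submodule.span ℝ S) (hFx : F x ≠ 0)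
    (hpx : p x ≤ A) (hz : z ∈ Λ) (hzS : z ∉ Submodule.span ℝ S) (hpz : p z ≤ A)
    (hFz : |F z| ≤ M * |F x|) :
    ∃ z' ∈ Λ, z' ∉ Submodule.span ℝ S ∧ p z' ≤ (1 + M + Module.finrank ℝ E) * A ∧
      |F z'| ≤ Module.finrank ℝ E * B := by
  have hv : (F z / F x) • x ∈ Submodule.span ℝ S := Submodule.smul_mem _ _ hx
  obtain ⟨w, hwΛ, hwS, hw⟩ := exists_round_mem_span Λ hS hv
  refine ⟨z - w, Λ.sub_mem hz hwΛ, fun h => hzS ?_, ?_, ?_⟩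
  · simpa using Submodule.add_mem _ h hwS
  · have h1 := hw p A hA hpS
    have h2 : p (z - w) ≤ p (z - (F z / F x) • x) + p ((F z / F x) • x - w) := by
      simpa using map_add_le_add p (z - (F z / F x) • x) ((F z / F x) • x - w)
    have h3 : p (z - (F z / F x) • x) ≤ p z + p ((F z / F x) • x) := map_sub_le_add p _ _
    have h4 : p ((F z / F x) • x) ≤ M * A := by
      rw [map_smul_eq_mul, Real.norm_eq_abs, abs_div]
      have h5 : |F z| / |F x| ≤ M := (div_le_iff₀ (abs_pos.2 hFx)).2 hFz
      have h6 : 0 ≤ |F z| / |F x| := by positivity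
      exact mul_le_mul h5 hpx (apply_nonneg p x) (h6.trans h5)
    linarith
  · have h1 := hw ((normSeminorm ℝ ℝ).comp F) B hB hFS
    have h2 : F ((F z / F x) • x - w) = F (z - w) := by
      rw [map_sub, map_sub, map_smul, smul_eq_mul, div_mul_cancel₀ _ hFx]
    simpa [h2] using h1

/-- The Leibniz bound for a determinant in terms of bounds for its columns. -/
theorem abs_det_le_factorial_mul_prod {ι : Type*} [Fintype ι] [DecidableEq ι]
    (A : Matrix ι ι ℝ) (d : ι → ℝ) (h : ∀ i j, |A i j| ≤ d j) :
    |A.det| ≤ (Fintype.card ι).factorial * ∏ j, d j := by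
  rw [Matrix.det_apply]
  calc |∑ σ : Equiv.Perm ι, Equiv.Perm.sign σ • ∏ i, A (σ i) i|
      ≤ ∑ σ : Equiv.Perm ι, |Equiv.Perm.sign σ • ∏ i, A (σ i) i| :=
        Finset.abs_sum_le_sum_abs _ _
    _ ≤ ∑ _σ : Equiv.Perm ι, ∏ j, d j := by
        refine Finset.sum_le_sum fun σ _ => ?_
        rw [Units.smul_def, zsmul_eq_mul, abs_mul, ← Int.cast_abs, Int.isUnit_iff_abs_eq.1
          (Equiv.Perm.sign σ).isUnit, Int.cast_one, one_mul, Finset.abs_prod]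
        exact Finset.prod_le_prod (fun _ _ => abs_nonneg _) fun i _ => h _ _
    _ = _ := by simp [Fintype.card_perm]

/-- The vectors of `ℝ^m × ℝ` with integer coordinates. -/
def intLattice (m : ℕ) : AddSubgroup (Fin m ⊕ Fin 1 → ℝ) :=
  ((Int.castAddHom ℝ).compLeft (Fin m ⊕ Fin 1)).range

theorem mem_intLattice {m : ℕ} {w : Fin m ⊕ Fin 1 → ℝ} :
    w ∈ intLattice m ↔ ∃ a : Fin m ⊕ Fin 1 → ℤ, (fun k => (a k : ℝ)) = w :=
  Iff.rfl

/-- The seminorm `(𝒙, y) ↦ ‖𝒙‖`. -/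
noncomputable def fstSeminorm (m : ℕ) : Seminorm ℝ (Fin m ⊕ Fin 1 → ℝ) :=
  (normSeminorm ℝ (Fin m → ℝ)).comp (LinearMap.funLeft ℝ ℝ Sum.inl)

theorem fstSeminorm_apply {m : ℕ} (w : Fin m ⊕ Fin 1 → ℝ) :
    fstSeminorm m w = ‖fun j => w (Sum.inl j)‖ :=
  rfl

/-- The linear form `(𝒙, y) ↦ ξ𝒙 - y`. -/
noncomputable def remForm {m : ℕ} (ξ : Matrix (Fin 1) (Fin m) ℝ) :
    (Fin m ⊕ Fin 1 → ℝ) →ₗ[ℝ] ℝ :=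
  (∑ j, ξ 0 j • LinearMap.proj (Sum.inl j)) - LinearMap.proj (Sum.inr 0)

theorem remForm_apply {m : ℕ} (ξ : Matrix (Fin 1) (Fin m) ℝ) (w : Fin m ⊕ Fin 1 → ℝ) :
    remForm ξ w = ∑ j, ξ 0 j * w (Sum.inl j) - w (Sum.inr 0) := by
  simp [remForm]

/-- The lattice vector of `ℝ^m × ℝ` with the given integer coordinates. -/
def latticeVec {m : ℕ} (u : Fin m → ℤ) (v : Fin 1 → ℤ) : Fin m ⊕ Fin 1 → ℝ :=
  Sum.elim (fun j => (u j : ℝ)) fun k => (v k : ℝ)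

theorem latticeVec_mem {m : ℕ} (u : Fin m → ℤ) (v : Fin 1 → ℤ) :
    latticeVec u v ∈ intLattice m :=
  mem_intLattice.2 ⟨Sum.elim u v, by ext (j | j) <;> rfl⟩

theorem abs_remForm_latticeVec {m : ℕ} (ξ : Matrix (Fin 1) (Fin m) ℝ) (u : Fin m → ℤ)
    (v : Fin 1 → ℤ) : |remForm ξ (latticeVec u v)| =
      ‖(ξ.mulVec (fun j => (u j : ℝ)) - (fun k => (v k : ℝ)))‖ := by
  rw [norm_fin_one, remForm_apply]
  rfl

/-- If the lattice vectors with `‖𝒙‖ ≤ a` and `|ξ𝒙 - y| ≤ b` span the whole space, then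
`a ^ m * b` is bounded below. -/
theorem one_le_of_span_eq_top {m : ℕ} (ξ : Matrix (Fin 1) (Fin m) ℝ) {a b : ℝ}
    (h : Submodule.span ℝ {w | w ∈ intLattice m ∧ fstSeminorm m w ≤ a ∧ |remForm ξ w| ≤ b} = ⊤) :
    1 ≤ ((m + 1).factorial : ℝ) * (a ^ m * b) := by
  obtain ⟨s, hsS, hspan, hli⟩ := exists_linearIndependent ℝ
    {w | w ∈ intLattice m ∧ fstSeminorm m w ≤ a ∧ |remForm ξ w| ≤ b}
  have : Fintype s := hli.setFinite.fintype
  have hcard : Fintype.card s = Fintype.card (Fin m ⊕ Fin 1) := by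
    have := finrank_span_set_eq_card hli
    rw [hspan, h, finrank_top, Module.finrank_fintype_fun_eq_card] at this
    rw [this, Set.toFinset_card]
  let e := Fintype.equivOfCardEq hcard.symm
  let R : Matrix (Fin m ⊕ Fin 1) (Fin m ⊕ Fin 1) ℝ := Matrix.of fun i => (e i : Fin m ⊕ Fin 1 → ℝ)
  have hR : R.det ≠ 0 := by
    have h1 : LinearIndependent ℝ R.row := hli.comp e e.injective
    exact ((Matrix.isUnit_iff_isUnit_det R).1
      (Matrix.linearIndependent_rows_iff_isUnit.1 h1)).ne_zero
  choose Z hZ using fun i => mem_intLattice.1 (hsS (e i).2).1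
  have hRZ : R = (Matrix.of Z).map (Int.cast : ℤ → ℝ) := by
    ext i j
    exact (congrFun (hZ i) j).symm
  have hdetZ : R.det = ((Matrix.of Z).det : ℤ) := by
    rw [hRZ]
    exact ((Int.castRingHom ℝ).map_det (Matrix.of Z)).symm
  have hone : 1 ≤ |R.det| := by
    rw [hdetZ] at hR ⊢
    exact_mod_cast Int.one_le_abs (by exact_mod_cast hR)
  let U : Matrix (Fin m ⊕ Fin 1) (Fin m ⊕ Fin 1) ℝ :=
    Matrix.fromBlocks 1 (Matrix.transpose ξ) 0 (-1)
  have hU : |U.det| = 1 := by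
    simp [U, Matrix.det_fromBlocks_zero₂₁]
  have hbound := abs_det_le_factorial_mul_prod (R * U) (Sum.elim (fun _ => a) fun _ => b) ?_
  · rw [Matrix.det_mul, abs_mul, hU, mul_one] at hbound
    simpa using hone.trans hbound
  · rintro i (j | j)
    · have h1 : (R * U) i (Sum.inl j) = (e i : Fin m ⊕ Fin 1 → ℝ) (Sum.inl j) := by
        simp [R, U, Matrix.mul_apply, Matrix.one_apply]
      rw [h1]
      exact (norm_le_pi_norm (fun j => (e i : Fin m ⊕ Fin 1 → ℝ) (Sum.inl j)) j).trans
        (hsS (e i).2).2.1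
    · have h1 : (R * U) i (Sum.inr j) = remForm ξ (e i) := by
        rw [Subsingleton.elim j 0]
        simp [R, U, Matrix.mul_apply, remForm_apply, mul_comm, sub_eq_add_neg]
      rw [h1]
      exact (hsS (e i).2).2.2

section BestApprox

variable {m : ℕ} {ξ : Matrix (Fin 1) (Fin m) ℝ} {x : ℕ → Fin m → ℤ} {y : ℕ → Fin 1 → ℤ}

theorem IsBestApproxSeq.lval_pos (hxy : IsBestApproxSeq ξ x y) (i : ℕ) : 0 < Lval ξ x y i :=
  (norm_nonneg _).trans_lt (hxy.lStrictAnti i.lt_succ_self)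

theorem IsBestApproxSeq.add_one_le_xval (hxy : IsBestApproxSeq ξ x y) (i : ℕ) :
    (i : ℝ) + 1 ≤ Xval x i := by
  induction i with
  | zero => simp [hxy.first]
  | succ i ih =>
    obtain ⟨k, hk⟩ := exists_nat_norm_intCast (x i)
    obtain ⟨l, hl⟩ := exists_nat_norm_intCast (x (i + 1))
    have h := hxy.xStrictMono i.lt_succ_self
    simp only [Xval, Nat.succ_eq_add_one] at h ih ⊢
    rw [hk] at h ih
    rw [hl] at h ⊢
    have h' : k + 1 ≤ l := by exact_mod_cast h
    have h'' : (k : ℝ) + 1 ≤ l := by exact_mod_cast h'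
    push_cast
    linarith

theorem IsBestApproxSeq.one_le_xval (hxy : IsBestApproxSeq ξ x y) (i : ℕ) : 1 ≤ Xval x i := by
  have := hxy.add_one_le_xval i
  have : (0 : ℝ) ≤ i := i.cast_nonneg
  linarith

/-- It suffices to test bad approximability on the best approximations. -/
theorem IsBestApproxSeq.propA_of_forall_le (hxy : IsBestApproxSeq ξ x y) {c : ℝ} (hc : 0 < c)
    (h : ∀ i, c ≤ Xval x i ^ m * Lval ξ x y i) : PropA ξ := by
  refine ⟨c, hc, fun u v hu => ?_⟩
  have hex : ∃ i, ‖(fun j => (u j : ℝ))‖ < Xval x (i + 1) := by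
    obtain ⟨i, hi⟩ := exists_nat_gt ‖(fun j => (u j : ℝ))‖
    refine ⟨i, ?_⟩
    have := hxy.add_one_le_xval (i + 1)
    push_cast at this
    linarith
  classical
  have hlt := Nat.find_spec hex
  have hle : Xval x (Nat.find hex) ≤ ‖(fun j => (u j : ℝ))‖ := by
    rcases hcase : Nat.find hex with _ | k
    · rw [hxy.first]
      obtain ⟨k, hk⟩ := exists_nat_norm_intCast u
      rw [hk]
      have hk0 : k ≠ 0 := by
        rintro rfl
        apply hu
        rw [Nat.cast_zero, norm_eq_zero] at hk
        ext j
        have hj : (u j : ℝ) = 0 := congrFun hk j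
        exact_mod_cast hj
      exact_mod_cast Nat.one_le_iff_ne_zero.2 hk0
    · exact not_lt.1 (Nat.find_min hex (by omega : k < Nat.find hex))
  rw [pow_one]
  refine (h (Nat.find hex)).trans (mul_le_mul ?_ (hxy.best _ u v hu hlt) (norm_nonneg _)
    (by positivity))
  exact pow_le_pow_left₀ (norm_nonneg _) hle m

/-- Bad approximability bounds the ratios of consecutive minimal remainders. -/
theorem IsBestApproxSeq.propC_of_propA (hm : 1 ≤ m) (hxy : IsBestApproxSeq ξ x y)
    (hA : PropA ξ) : PropC ξ x y := by
  obtain ⟨c, hc, hA⟩ := hA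
  refine ⟨2 ^ m / c, fun i => ?_⟩
  have hL := hxy.lval_pos (i + 1)
  have h1 : c ≤ Xval x (i + 1) ^ m * Lval ξ x y (i + 1) := by
    simpa [Xval, Lval] using hA (x (i + 1)) (y (i + 1)) (hxy.nonzero _)
  obtain ⟨k, hk⟩ : ∃ k : ℕ, Xval x (i + 1) = k := exists_nat_norm_intCast _
  have hk2 : 2 ≤ k := by
    have := hxy.add_one_le_xval (i + 1)
    rw [hk] at this
    norm_cast at this
    omega
  obtain ⟨N, rfl⟩ : ∃ N, k = N + 1 := ⟨k - 1, by omega⟩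
  have hN : 1 ≤ N := by omega
  obtain ⟨u, v, hu, huN, huv⟩ := exists_linearForm_near_int hm (ξ 0) hN
  have h2 : Lval ξ x y i ≤ 1 / (N : ℝ) ^ m := by
    refine (hxy.best i u (fun _ => v) hu ?_).trans ?_
    · rw [hk]
      push_cast
      have : ‖(fun j => (u j : ℝ))‖ ≤ N := (pi_norm_le_iff_of_nonneg (by positivity)).2 huN
      linarith
    · rw [norm_fin_one]
      exact huv
  have hN1 : (1 : ℝ) ≤ N := by exact_mod_cast hN
  have h3 : Xval x (i + 1) ^ m ≤ 2 ^ m * (N : ℝ) ^ m := by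
    rw [hk, ← mul_pow]
    push_cast
    gcongr
    linarith
  rw [div_le_div_iff₀ hL hc]
  calc Lval ξ x y i * c ≤ 1 / (N : ℝ) ^ m * (2 ^ m * (N : ℝ) ^ m * Lval ξ x y (i + 1)) := by
        refine mul_le_mul h2 (h1.trans ?_) hc.le (by positivity)
        gcongr
    _ = 2 ^ m * Lval ξ x y (i + 1) := by
        field_simp

/-- If the `i`-th best approximation lies in a proper subspace `V`, then some best approximation
of index at most `i` lies in `V` while a comparable lattice vector does not. -/
theorem IsBestApproxSeq.exists_notMem (hxy : IsBestApproxSeq ξ x y) {M : ℝ}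
    (hM : ∀ i, Lval ξ x y i ≤ M * Lval ξ x y (i + 1))
    (hM0 : ∀ k, |remForm ξ (Pi.single k 1)| ≤ M * Lval ξ x y 0)
    {V : Submodule ℝ (Fin m ⊕ Fin 1 → ℝ)} (hV : V ≠ ⊤) (i : ℕ)
    (hi : latticeVec (x i) (y i) ∈ V) :
    ∃ h ≤ i, latticeVec (x h) (y h) ∈ V ∧ ∃ z ∈ intLattice m, z ∉ V ∧
      fstSeminorm m z ≤ Xval x h ∧ |remForm ξ z| ≤ M * Lval ξ x y h := by
  induction i with
  | zero =>
    refine ⟨0, le_rfl, hi, ?_⟩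
    have hk : ∃ k, (Pi.single k 1 : Fin m ⊕ Fin 1 → ℝ) ∉ V := by
      by_contra! hall
      apply hV
      rw [eq_top_iff, ← (Pi.basisFun ℝ (Fin m ⊕ Fin 1)).span_eq, Submodule.span_le]
      rintro _ ⟨k, rfl⟩
      simpa using hall k
    obtain ⟨k, hk⟩ := hk
    refine ⟨Pi.single k 1, mem_intLattice.2 ⟨Pi.single k 1, ?_⟩, hk, ?_, hM0 k⟩
    · ext l
      by_cases hl : l = k
      · subst hl; simp
      · simp [hl]
    · rw [hxy.first, fstSeminorm_apply, pi_norm_le_iff_of_nonneg zero_le_one]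
      intro j
      by_cases hl : Sum.inl j = k
      · subst hl; simp
      · simp [hl]
  | succ i ih =>
    by_cases hmem : latticeVec (x i) (y i) ∈ V
    · obtain ⟨h, hle, hrest⟩ := ih hmem
      exact ⟨h, by omega, hrest⟩
    · refine ⟨i + 1, le_rfl, hi, latticeVec (x i) (y i), latticeVec_mem _ _, hmem,
        (hxy.xStrictMono i.lt_succ_self).le, ?_⟩
      rw [abs_remForm_latticeVec]
      exact hM i

/-- Bounded ratios of consecutive minimal remainders imply bad approximability. -/
theorem IsBestApproxSeq.propA_of_propC (hxy : IsBestApproxSeq ξ x y) (hC : PropC ξ x y) :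
    PropA ξ := by
  obtain ⟨M₀, hM₀⟩ := hC
  obtain ⟨M, hM, hM0⟩ : ∃ M, (∀ i, Lval ξ x y i ≤ M * Lval ξ x y (i + 1)) ∧
      ∀ k, |remForm ξ (Pi.single k 1)| ≤ M * Lval ξ x y 0 := by
    refine ⟨max M₀ ((∑ k, |remForm ξ (Pi.single k 1)|) / Lval ξ x y 0), fun i => ?_, fun k => ?_⟩
    · exact (div_le_iff₀ (hxy.lval_pos _)).1 ((hM₀ i).trans (le_max_left _ _))
    · rw [← div_le_iff₀ (hxy.lval_pos _)]
      refine le_trans ?_ (le_max_right _ _)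
      have := (hxy.lval_pos 0).le
      gcongr
      exact Finset.single_le_sum (f := fun k => |remForm ξ (Pi.single k 1)|)
        (fun _ _ => abs_nonneg _) (Finset.mem_univ k)
  have hMnn : 0 ≤ M := by
    have h1 := hM 0
    nlinarith [hxy.lval_pos 0, hxy.lval_pos 1]
  let S : ℕ → ℝ → Set (Fin m ⊕ Fin 1 → ℝ) := fun i ρ =>
    {w | w ∈ intLattice m ∧ fstSeminorm m w ≤ ρ * Xval x i ∧ |remForm ξ w| ≤ ρ * Lval ξ x y i}
  have hSmono : ∀ i {ρ ρ' : ℝ}, ρ ≤ ρ' → S i ρ ⊆ S i ρ' := by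
    rintro i ρ ρ' hρ w ⟨h1, h2, h3⟩
    have hL := (hxy.lval_pos i).le
    have hX := hxy.one_le_xval i
    exact ⟨h1, h2.trans (by gcongr), h3.trans (by gcongr)⟩
  let d : ℝ := Module.finrank ℝ (Fin m ⊕ Fin 1 → ℝ)
  have hd : 0 ≤ d := Nat.cast_nonneg _
  let C : ℝ := 1 + M + d
  have hC1 : 1 ≤ C := by simp only [C]; linarith
  have hrank : ∀ i k, k ≤ m + 1 → k ≤ Module.finrank ℝ (Submodule.span ℝ (S i (C ^ k))) := by
    intro i k
    induction k with
    | zero => simp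
    | succ k ih =>
      intro hk
      have hL := hxy.lval_pos i
      have hX := hxy.one_le_xval i
      have hρ : 1 ≤ C ^ k := one_le_pow₀ hC1
      have hsub : Submodule.span ℝ (S i (C ^ k)) ≤ Submodule.span ℝ (S i (C ^ (k + 1))) :=
        Submodule.span_mono (hSmono i (pow_le_pow_right₀ hC1 k.le_succ))
      by_cases htop : Submodule.span ℝ (S i (C ^ k)) = ⊤
      · rw [htop, top_le_iff] at hsub
        rw [hsub, finrank_top]
        simpa using hk
      have hi : latticeVec (x i) (y i) ∈ Submodule.span ℝ (S i (C ^ k)) := by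
        refine Submodule.subset_span ⟨latticeVec_mem _ _, ?_, ?_⟩
        · exact le_mul_of_one_le_left (apply_nonneg _ _) hρ
        · rw [abs_remForm_latticeVec]
          exact le_mul_of_one_le_left hL.le hρ
      obtain ⟨h, hle, hh, z, hz, hzV, hpz, hFz⟩ := hxy.exists_notMem hM hM0 htop i hi
      have hXh : Xval x h ≤ C ^ k * Xval x i :=
        (hxy.xStrictMono.monotone hle).trans (le_mul_of_one_le_left (by linarith) hρ)
      have hFh : |remForm ξ (latticeVec (x h) (y h))| = Lval ξ x y h :=
        abs_remForm_latticeVec _ _ _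
      obtain ⟨z', hz', hzV', hpz', hFz'⟩ := exists_notMem_span_small (intLattice m)
        (fun _ hs => hs.1) (fstSeminorm m) (remForm ξ) (by positivity) (by positivity)
        (fun _ hs => hs.2.1) (fun _ hs => hs.2.2) hh
        (abs_pos.1 (hFh ▸ hxy.lval_pos h)) hXh hz hzV (hpz.trans hXh)
        (by rwa [hFh])
      have hmem : z' ∈ Submodule.span ℝ (S i (C ^ (k + 1))) := by
        refine Submodule.subset_span ⟨hz', hpz'.trans_eq ?_, hFz'.trans ?_⟩
        · rw [pow_succ', mul_assoc]
        · rw [pow_succ', mul_assoc]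
          gcongr
          change d ≤ C
          simp only [C]
          linarith
      have := Submodule.finrank_lt_finrank_of_lt
        (lt_of_le_of_ne hsub fun heq => hzV' (heq ▸ hmem))
      have := ih (by omega)
      omega
  let T : ℝ := C ^ (m + 1)
  have hT : 0 < T := by positivity
  refine hxy.propA_of_forall_le (c := 1 / ((m + 1).factorial * T ^ (m + 1))) (by positivity)
    fun i => ?_
  have htop : Submodule.span ℝ (S i T) = ⊤ := by
    apply Submodule.eq_top_of_finrank_eq
    refine le_antisymm (Submodule.finrank_le _) ?_
    simpa using hrank i (m + 1) le_rfl
  have h1 := one_le_of_span_eq_top ξ htop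
  rw [div_le_iff₀ (by positivity)]
  refine h1.trans_eq ?_
  clear_value T
  ring

end BestApprox

/-- For `n = 1`, property (C) implies property (A); in particular
(A) and (C) are equivalent. -/
theorem stmt_3 (m : ℕ) (hm : 1 ≤ m)
    (ξ : Matrix (Fin 1) (Fin m) ℝ) (hirr : TotallyIrrational ξ)
    (x : ℕ → Fin m → ℤ) (y : ℕ → Fin 1 → ℤ) (hxy : IsBestApproxSeq ξ x y) :
    (PropC ξ x y → PropA ξ) ∧ (PropA ξ ↔ PropC ξ x y) := by
  exact ⟨hxy.propA_of_propC, hxy.propC_of_propA hm, hxy.propA_of_propC⟩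
end
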